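/- arXiv:2605.01079 — 5 statements merged into one kernel-verified Lean document; each statement's English description precedes it below -/
import Mathlib

section
/- Let α > 0, λ ∈ ℂ, and let k be an integer with 0 ≤ k ≤ ⌈α⌉ − 1. Then for every t > 0 the function t ↦ R_{α,k}(λ,t) is an eigenfunction of the Riemann–Liouville fractional derivative of order α with eigenvalue λ: (^{RL} D^α) [R_{α,k}(λ,·)](t) = λ R_{α,k}(λ,t). -/
open MeasureTheory

/-- Two-parameter Mittag-Leffler function, using the entire reciprocal Gamma
function (Mathlib's `Complex.Gamma` vanishes at nonpositive integers, so its
inverse is the entire reciprocal Gamma). -/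
noncomputable def mlE (α β : ℝ) (z : ℂ) : ℂ :=
  ∑' n : ℕ, z ^ n * (Complex.Gamma ((α * n + β : ℝ) : ℂ))⁻¹

/-- The `P` function: `P_{α,w}(λ,t) = t^w E_{α,w+1}(λ t^α)`. -/
noncomputable def Pfun (α w : ℝ) (lam : ℂ) (t : ℝ) : ℂ :=
  ((t ^ w : ℝ) : ℂ) * mlE α (w + 1) (lam * ((t ^ α : ℝ) : ℂ))

/-- The `R` (Lorenzo–Hartley) function: `R_{α,v}(λ,t) = t^{α-v-1} E_{α,α-v}(λ t^α)`. -/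
noncomputable def Rfun (α v : ℝ) (lam : ℂ) (t : ℝ) : ℂ :=
  ((t ^ (α - v - 1) : ℝ) : ℂ) * mlE α (α - v) (lam * ((t ^ α : ℝ) : ℂ))

/-- The Riemann–Liouville fractional derivative of order `α > 0` based at `0`, with
`m = ⌈α⌉`: `(d/dt)^m [(1/Γ(m-α)) ∫_0^t f(z) (t-z)^(m-α-1) dz]` when `α < m`,
and `f^(m)(t)` when `α = m`. -/
noncomputable def rlDeriv (α : ℝ) (f : ℝ → ℂ) (t : ℝ) : ℂ :=
  if α = (⌈α⌉₊ : ℝ) then iteratedDeriv ⌈α⌉₊ f t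
  else iteratedDeriv ⌈α⌉₊
    (fun τ => ((Real.Gamma ((⌈α⌉₊ : ℝ) - α) : ℝ) : ℂ)⁻¹ *
      ∫ z in (0 : ℝ)..τ, f z * (((τ - z) ^ ((⌈α⌉₊ : ℝ) - α - 1) : ℝ) : ℂ)) t

open Set Filter Topology

/-- Markov-type lower bound for the Gamma function: `A ^ (s - 1) * exp (-A) ≤ Γ(s)`. -/
theorem Real.rpow_mul_exp_neg_le_Gamma {A s : ℝ} (hA : 0 < A) (hs : 1 ≤ s) :
    A ^ (s - 1) * Real.exp (-A) ≤ Real.Gamma s := by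
  have hs0 : 0 < s := by linarith
  have hint := Real.GammaIntegral_convergent hs0
  have hsub : Ioi A ⊆ Ioi (0 : ℝ) := Ioi_subset_Ioi hA.le
  rw [Real.Gamma_eq_integral hs0, ← integral_exp_neg_Ioi A, ← integral_const_mul]
  calc ∫ x in Ioi A, A ^ (s - 1) * Real.exp (-x)
      ≤ ∫ x in Ioi A, Real.exp (-x) * x ^ (s - 1) := by
        refine setIntegral_mono_on ((integrableOn_exp_neg_Ioi A).const_mul _)
          (hint.mono_set hsub) measurableSet_Ioi fun x hx => ?_
        rw [mul_comm]
        gcongr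
        exact (mem_Ioi.1 hx).le
    _ ≤ ∫ x in Ioi 0, Real.exp (-x) * x ^ (s - 1) := by
        refine setIntegral_mono_set hint ?_ hsub.eventuallyLE
        filter_upwards [ae_restrict_mem measurableSet_Ioi] with x hx
        have : 0 < x := hx
        simp only [Pi.zero_apply]
        positivity

theorem summable_pow_mul_abs_inv_Gamma {α : ℝ} (hα : 0 < α) (β : ℝ) {r : ℝ} (hr : 0 ≤ r) :
    Summable fun n : ℕ => r ^ n * |(Real.Gamma (α * n + β))⁻¹| := by
  set A : ℝ := (r + 1) ^ α⁻¹ with hA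
  have hA0 : 0 < A := by positivity
  have hAα : A ^ α = r + 1 := by
    rw [hA, ← Real.rpow_mul (by positivity), inv_mul_cancel₀ hα.ne', Real.rpow_one]
  have hgeo : Summable fun n : ℕ => (r / (r + 1)) ^ n * (A ^ (1 - β) * Real.exp A) :=
    (summable_geometric_of_lt_one (by positivity)
      ((div_lt_one (by positivity)).2 (by linarith))).mul_right _
  refine hgeo.of_norm_bounded_eventually_nat ?_
  obtain ⟨N, hN⟩ := exists_nat_ge ((1 - β) / α)
  filter_upwards [eventually_ge_atTop N] with n hn
  have hs : 1 ≤ α * n + β := by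
    have h1 : (1 - β) / α ≤ n := hN.trans (by exact_mod_cast hn)
    rw [div_le_iff₀ hα] at h1
    linarith
  have hG := Real.rpow_mul_exp_neg_le_Gamma hA0 hs
  have hpow : A ^ (α * n + β - 1) = (r + 1) ^ n * (A ^ (1 - β))⁻¹ := by
    rw [← hAα, ← Real.rpow_natCast, ← Real.rpow_mul hA0.le, ← Real.rpow_neg hA0.le,
      ← Real.rpow_add hA0]
    congr 1
    ring
  have hpos : 0 < A ^ (α * n + β - 1) * Real.exp (-A) := by positivity
  rw [Real.norm_of_nonneg (by positivity), abs_of_pos (inv_pos.2 (hpos.trans_le hG))]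
  calc r ^ n * (Real.Gamma (α * n + β))⁻¹
      ≤ r ^ n * (A ^ (α * n + β - 1) * Real.exp (-A))⁻¹ := by gcongr
    _ = _ := by
        rw [hpow, Real.exp_neg, div_pow]
        field_simp

theorem Real.inv_Gamma_eq_mul_inv_Gamma_add_one (s : ℝ) :
    (Real.Gamma s)⁻¹ = s * (Real.Gamma (s + 1))⁻¹ := by
  rcases eq_or_ne s 0 with rfl | h
  · simp
  · rw [Real.Gamma_add_one h, mul_inv, mul_inv_cancel_left₀ h]

theorem Rfun_eq_tsum (α v : ℝ) (lam : ℂ) {t : ℝ} (ht : 0 < t) :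
    Rfun α v lam t = ∑' n : ℕ, lam ^ n *
      ((t ^ (α * n + (α - v) - 1) * (Real.Gamma (α * n + (α - v)))⁻¹ : ℝ) : ℂ) := by
  rw [Rfun, mlE, ← tsum_mul_left]
  refine tsum_congr fun n => ?_
  have h : t ^ (α * n + (α - v) - 1) = t ^ (α - v - 1) * (t ^ α) ^ n := by
    rw [← Real.rpow_natCast, ← Real.rpow_mul ht.le, ← Real.rpow_add ht]
    congr 1
    ring
  rw [h, Complex.Gamma_ofReal]
  push_cast
  ring

theorem summable_Rfun_norm_bound {α : ℝ} (hα : 0 < α) (v : ℝ) (lam : ℂ) {t : ℝ} (ht : 0 < t) :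
    Summable fun n : ℕ => ‖lam ^ n *
      ((t ^ (α * n + (α - v) - 1) * (Real.Gamma (α * n + (α - v)))⁻¹ : ℝ) : ℂ)‖ := by
  have h := (summable_pow_mul_abs_inv_Gamma hα (α - v)
    (r := ‖lam‖ * t ^ α) (by positivity)).mul_left (t ^ (α - v - 1))
  refine h.congr fun n => ?_
  have h : t ^ (α * n + (α - v) - 1) = t ^ (α - v - 1) * (t ^ α) ^ n := by
    rw [← Real.rpow_natCast, ← Real.rpow_mul ht.le, ← Real.rpow_add ht]
    congr 1
    ring
  rw [norm_mul, norm_pow, Complex.norm_real, norm_mul, Real.norm_eq_abs, Real.norm_eq_abs,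
    abs_of_pos (Real.rpow_pos_of_pos ht _), h]
  ring

theorem hasDerivAt_Rfun {α : ℝ} (hα : 0 < α) (v : ℝ) (lam : ℂ) {t : ℝ} (ht : 0 < t) :
    HasDerivAt (Rfun α v lam) (Rfun α (v + 1) lam t) t := by
  set a := t / 2 with ha
  set b := 2 * t with hb
  have ha0 : 0 < a := by positivity
  have hb0 : 0 < b := by positivity
  have htm : t ∈ Ioo a b := ⟨by linarith, by linarith⟩
  have key := hasDerivAt_tsum_of_isPreconnected
    (g := fun (n : ℕ) (x : ℝ) => lam ^ n *
      ((x ^ (α * n + (α - v) - 1) * (Real.Gamma (α * n + (α - v)))⁻¹ : ℝ) : ℂ))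
    (g' := fun (n : ℕ) (x : ℝ) => lam ^ n *
      ((x ^ (α * n + (α - (v + 1)) - 1) * (Real.Gamma (α * n + (α - (v + 1))))⁻¹ : ℝ) : ℂ))
    ((summable_Rfun_norm_bound hα (v + 1) lam ha0).add
      (summable_Rfun_norm_bound hα (v + 1) lam hb0))
    isOpen_Ioo isPreconnected_Ioo (y₀ := t) (y := t) ?_ ?_ htm
    (summable_Rfun_norm_bound hα v lam ht).of_norm htm
  · rw [Rfun_eq_tsum α (v + 1) lam ht]
    refine key.congr_of_eventuallyEq ?_
    filter_upwards [eventually_gt_nhds ht] with x hx using Rfun_eq_tsum α v lam hx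
  · intro n y hy
    have hy0 : 0 < y := ha0.trans hy.1
    have h1 := ((Real.hasDerivAt_rpow_const (p := α * n + (α - v) - 1)
      (Or.inl hy0.ne')).mul_const (Real.Gamma (α * n + (α - v)))⁻¹).ofReal_comp.const_mul (lam ^ n)
    refine h1.congr_deriv ?_
    rw [Real.inv_Gamma_eq_mul_inv_Gamma_add_one (α * n + (α - (v + 1))),
      show α * n + (α - (v + 1)) + 1 = α * n + (α - v) by ring,
      show α * n + (α - v) - 1 = α * n + (α - (v + 1)) by ring]
    push_cast
    ring
  · intro n y hy
    have hy0 : 0 < y := ha0.trans hy.1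
    set p := α * n + (α - (v + 1)) - 1
    have hp : y ^ p ≤ a ^ p + b ^ p := by
      rcases le_total 0 p with h | h
      · have := Real.rpow_le_rpow hy0.le hy.2.le h
        have := Real.rpow_pos_of_pos ha0 p
        linarith
      · have := Real.rpow_le_rpow_of_nonpos ha0 hy.1.le h
        have := Real.rpow_pos_of_pos hb0 p
        linarith
    simp only [norm_mul, Complex.norm_real]
    rw [Real.norm_of_nonneg (Real.rpow_pos_of_pos hy0 p).le,
      Real.norm_of_nonneg (Real.rpow_pos_of_pos ha0 p).le,
      Real.norm_of_nonneg (Real.rpow_pos_of_pos hb0 p).le, ← mul_add, ← add_mul]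
    gcongr

theorem iteratedDeriv_Rfun {α : ℝ} (hα : 0 < α) (v : ℝ) (lam : ℂ) (m : ℕ) {t : ℝ} (ht : 0 < t) :
    iteratedDeriv m (Rfun α v lam) t = Rfun α (v + m) lam t := by
  induction m generalizing t with
  | zero => simp
  | succ m ih =>
    have h : iteratedDeriv m (Rfun α v lam) =ᶠ[𝓝 t] Rfun α (v + m) lam := by
      filter_upwards [eventually_gt_nhds ht] with x hx using ih hx
    rw [iteratedDeriv_succ, h.deriv_eq, (hasDerivAt_Rfun hα (v + m) lam ht).deriv]
    push_cast
    rw [add_assoc]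

theorem Rfun_add_self {α : ℝ} (hα : 0 < α) (k : ℕ) (lam : ℂ) {t : ℝ} (ht : 0 < t) :
    Rfun α (k + α) lam t = lam * Rfun α k lam t := by
  rw [Rfun_eq_tsum _ _ _ ht, Rfun_eq_tsum _ _ _ ht,
    (summable_Rfun_norm_bound hα (k + α) lam ht).of_norm.tsum_eq_zero_add, ← tsum_mul_left]
  have h0 : Real.Gamma (α * (0 : ℕ) + (α - (k + α))) = 0 := by
    rw [show α * (0 : ℕ) + (α - (k + α)) = -(k : ℝ) by push_cast; ring]
    exact Real.Gamma_neg_nat_eq_zero k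
  rw [h0, inv_zero, mul_zero, Complex.ofReal_zero, mul_zero, zero_add]
  refine tsum_congr fun n => ?_
  rw [show α * ((n + 1 : ℕ) : ℝ) + (α - (k + α)) = α * n + (α - k) by push_cast; ring, pow_succ]
  ring

theorem integral_rpow_mul_sub_rpow {a c τ : ℝ} (ha : 0 < a) (hc : 0 < c) (hτ : 0 < τ) :
    ∫ z in (0 : ℝ)..τ, z ^ (a - 1) * (τ - z) ^ (c - 1) =
      τ ^ (a + c - 1) * (Real.Gamma a * Real.Gamma c / Real.Gamma (a + c)) := by
  have h := Complex.betaIntegral_scaled (a : ℂ) (c : ℂ) hτ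
  rw [Complex.betaIntegral_eq_Gamma_mul_div _ _ (by simpa using ha) (by simpa using hc)] at h
  apply Complex.ofReal_injective
  rw [← intervalIntegral.integral_ofReal, Complex.ofReal_mul, Complex.ofReal_cpow hτ.le]
  push_cast [← Complex.Gamma_ofReal]
  rw [← h]
  refine intervalIntegral.integral_congr fun z hz => ?_
  rw [uIcc_of_le hτ.le] at hz
  rw [Complex.ofReal_cpow hz.1, Complex.ofReal_cpow (sub_nonneg.2 hz.2)]
  push_cast
  rfl

theorem integral_Rfun_mul_sub_rpow {α v c τ : ℝ} (hα : 0 < α) (hv : v < α) (hc : 0 < c)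
    (lam : ℂ) (hτ : 0 < τ) :
    ∫ z in (0 : ℝ)..τ, Rfun α v lam z * (((τ - z) ^ (c - 1) : ℝ) : ℂ) =
      (Real.Gamma c : ℂ) * Rfun α (v - c) lam τ := by
  have hpos (n : ℕ) : 0 < α * n + (α - v) := by
    have : 0 ≤ α * n := by positivity
    linarith
  have hΓ (n : ℕ) : 0 < Real.Gamma (α * n + (α - v)) := Real.Gamma_pos_of_pos (hpos n)
  have hΓc : 0 < Real.Gamma c := Real.Gamma_pos_of_pos hc
  have hΓ' (n : ℕ) : 0 < Real.Gamma (α * n + (α - v) + c) :=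
    Real.Gamma_pos_of_pos (add_pos (hpos n) hc)
  set K : ℕ → ℝ → ℝ := fun n z => z ^ (α * n + (α - v) - 1) * (τ - z) ^ (c - 1) with hK
  have hKint (n : ℕ) : ∫ z in Ioc 0 τ, K n z = τ ^ (α * n + (α - v) + c - 1) *
      (Real.Gamma (α * n + (α - v)) * Real.Gamma c / Real.Gamma (α * n + (α - v) + c)) := by
    rw [← intervalIntegral.integral_of_le hτ.le]
    exact integral_rpow_mul_sub_rpow (hpos n) hc hτ
  have hKi (n : ℕ) : IntegrableOn (K n) (Ioc 0 τ) := by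
    refine Integrable.of_integral_ne_zero ?_
    rw [hKint]
    have := hΓ n
    have := hΓ' n
    positivity
  have hK0 (n : ℕ) {z : ℝ} (hz : z ∈ Ioc 0 τ) : 0 ≤ K n z :=
    mul_nonneg (Real.rpow_nonneg hz.1.le _) (Real.rpow_nonneg (sub_nonneg.2 hz.2) _)
  set F : ℕ → ℝ → ℂ := fun n z =>
    (lam ^ n * ((Real.Gamma (α * n + (α - v)))⁻¹ : ℝ)) * (K n z : ℂ) with hF
  have hnorm (n : ℕ) : ∫ z in Ioc 0 τ, ‖F n z‖ = Real.Gamma c * ‖lam ^ n *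
      ((τ ^ (α * n + (α - (v - c)) - 1) * (Real.Gamma (α * n + (α - (v - c))))⁻¹ : ℝ) : ℂ)‖ := by
    have : ∫ z in Ioc 0 τ, ‖F n z‖ =
        ∫ z in Ioc 0 τ, ‖lam‖ ^ n * (Real.Gamma (α * n + (α - v)))⁻¹ * K n z := by
      refine setIntegral_congr_fun measurableSet_Ioc fun z hz => ?_
      simp only [hF, norm_mul, norm_pow, Complex.norm_real]
      rw [Real.norm_of_nonneg (hK0 n hz), Real.norm_of_nonneg (inv_pos.2 (hΓ n)).le]
    rw [this, integral_const_mul, hKint, norm_mul, norm_pow, Complex.norm_real,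
      show α * n + (α - (v - c)) = α * n + (α - v) + c by ring, Real.norm_of_nonneg
        (mul_pos (Real.rpow_pos_of_pos hτ _) (inv_pos.2 (hΓ' n))).le]
    have := (hΓ n).ne'
    field_simp
  have hsum := hasSum_integral_of_summable_integral_norm (μ := volume.restrict (Ioc 0 τ)) (F := F)
    (fun n => (hKi n).ofReal.const_mul _)
    (by simpa only [hnorm] using (summable_Rfun_norm_bound hα (v - c) lam hτ).mul_left _)
  rw [intervalIntegral.integral_of_le hτ.le, Rfun_eq_tsum _ _ _ hτ, ← tsum_mul_left]
  calc ∫ z in Ioc 0 τ, Rfun α v lam z * (((τ - z) ^ (c - 1) : ℝ) : ℂ)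
      = ∫ z in Ioc 0 τ, ∑' n, F n z := by
        refine setIntegral_congr_fun measurableSet_Ioc fun z hz => ?_
        rw [Rfun_eq_tsum _ _ _ hz.1, ← tsum_mul_right]
        refine tsum_congr fun n => ?_
        simp only [hF, hK]
        push_cast
        ring
    _ = ∑' n, ∫ z in Ioc 0 τ, F n z := hsum.tsum_eq.symm
    _ = _ := by
        refine tsum_congr fun n => ?_
        simp only [hF]
        rw [integral_const_mul, integral_complex_ofReal, hKint,
          show α * n + (α - (v - c)) = α * n + (α - v) + c by ring]
        have h1 : (Real.Gamma (α * n + (α - v)) : ℂ) ≠ 0 := by exact_mod_cast (hΓ n).ne'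
        push_cast at h1 ⊢
        field_simp

/-- For `α > 0`, `λ ∈ ℂ` and an integer `k` with `0 ≤ k ≤ ⌈α⌉ - 1`,
`R_{α,k}(λ,·)` is an eigenfunction of the Riemann–Liouville derivative of order `α`
with eigenvalue `λ`. -/
theorem riemannLiouville_eigenfunction_Rfun (α : ℝ) (hα : 0 < α) (lam : ℂ)
    (k : ℕ) (hk : k < ⌈α⌉₊) (t : ℝ) (ht : 0 < t) :
    rlDeriv α (fun τ => Rfun α (k : ℝ) lam τ) t = lam * Rfun α (k : ℝ) lam t := by
  have hkα : (k : ℝ) < α := Nat.lt_ceil.1 hk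
  rw [rlDeriv, ← Rfun_add_self hα k lam ht]
  split_ifs with h
  · exact (iteratedDeriv_Rfun hα k lam _ ht).trans (by rw [← h])
  · have hc : 0 < (⌈α⌉₊ : ℝ) - α := sub_pos.2 ((Nat.le_ceil α).lt_of_ne h)
    have hev : (fun τ => ((Real.Gamma ((⌈α⌉₊ : ℝ) - α) : ℝ) : ℂ)⁻¹ *
        ∫ z in (0 : ℝ)..τ, Rfun α k lam z * (((τ - z) ^ ((⌈α⌉₊ : ℝ) - α - 1) : ℝ) : ℂ))
        =ᶠ[𝓝 t] Rfun α (k - ((⌈α⌉₊ : ℝ) - α)) lam := by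
      filter_upwards [eventually_gt_nhds ht] with τ hτ
      have hΓ : ((Real.Gamma ((⌈α⌉₊ : ℝ) - α) : ℝ) : ℂ) ≠ 0 := by
        exact_mod_cast (Real.Gamma_pos_of_pos hc).ne'
      rw [integral_Rfun_mul_sub_rpow hα hkα hc lam hτ, inv_mul_cancel_left₀ hΓ]
    rw [hev.iteratedDeriv_eq, iteratedDeriv_Rfun hα _ lam _ ht]
    congr 1
    ring
end

section
/- Let α, β > 0, w₁, w₂ > −1, λ, σ ∈ ℂ, and set w = w₁ + w₂. Then for every t > 0 the causal convolution of P_{α,w₁}(λ,·) and P_{β,w₂}(σ,·) is given by the convergent series ∫_0^t P_{α,w₁}(λ,t−τ) P_{β,w₂}(σ,τ) dτ = ∑_{k=0}^∞ σᵏ P_{α, w+βk+1}(λ,t), and equally = ∑_{j=0}^∞ λʲ P_{β, w+αj+1}(σ,t). -/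
open MeasureTheory

/-- The Riemann–Liouville kernel `t ^ (a - 1) / Γ(a)`. -/
noncomputable def rlKernel (a t : ℝ) : ℝ := t ^ (a - 1) * (Real.Gamma a)⁻¹

lemma rlKernel_pos {a t : ℝ} (ha : 0 < a) (ht : 0 < t) : 0 < rlKernel a t :=
  mul_pos (Real.rpow_pos_of_pos ht _) (inv_pos.2 (Real.Gamma_pos_of_pos ha))

/-- The Riemann–Liouville kernels form a convolution semigroup. -/
lemma integral_rlKernel_mul_rlKernel {a b t : ℝ} (ha : 0 < a) (hb : 0 < b) (ht : 0 < t) :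
    ∫ τ in (0 : ℝ)..t, rlKernel a (t - τ) * rlKernel b τ = rlKernel (a + b) t := by
  have hbeta := Complex.betaIntegral_scaled (b : ℂ) (a : ℂ) ht
  rw [Complex.betaIntegral_eq_Gamma_mul_div _ _ (by simpa using hb) (by simpa using ha)] at hbeta
  have hint : ∫ τ in (0 : ℝ)..t, τ ^ (b - 1) * (t - τ) ^ (a - 1) =
      t ^ (b + a - 1) * (Real.Gamma b * Real.Gamma a / Real.Gamma (b + a)) := by
    apply Complex.ofReal_injective
    rw [← intervalIntegral.integral_ofReal]
    push_cast [Complex.ofReal_cpow ht.le, ← Complex.Gamma_ofReal]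
    rw [← hbeta]
    apply intervalIntegral.integral_congr
    intro τ hτ
    rw [Set.uIcc_of_le ht.le] at hτ
    simp only
    rw [Complex.ofReal_cpow hτ.1, Complex.ofReal_cpow (sub_nonneg.2 hτ.2)]
    push_cast
    rfl
  have hΓa := (Real.Gamma_pos_of_pos ha).ne'
  have hΓb := (Real.Gamma_pos_of_pos hb).ne'
  calc ∫ τ in (0 : ℝ)..t, rlKernel a (t - τ) * rlKernel b τ
      = ∫ τ in (0 : ℝ)..t, (τ ^ (b - 1) * (t - τ) ^ (a - 1)) *
          ((Real.Gamma a)⁻¹ * (Real.Gamma b)⁻¹) := by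
        congr 1; ext τ; unfold rlKernel; ring
    _ = rlKernel (a + b) t := by
        rw [intervalIntegral.integral_mul_const, hint, rlKernel, add_comm b a]
        field_simp

lemma integrableOn_rlKernel_mul_rlKernel {a b t : ℝ} (ha : 0 < a) (hb : 0 < b) (ht : 0 < t) :
    IntegrableOn (fun τ => rlKernel a (t - τ) * rlKernel b τ) (Set.Ioo 0 t) := by
  rw [← integrableOn_Ioc_iff_integrableOn_Ioo,
    ← intervalIntegrable_iff_integrableOn_Ioc_of_le ht.le]
  by_contra h
  have h_zero := intervalIntegral.integral_undef h
  rw [integral_rlKernel_mul_rlKernel ha hb ht] at h_zero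
  exact (rlKernel_pos (add_pos ha hb) ht).ne' h_zero

lemma rpow_mul_exp_neg_le_Gamma {y R : ℝ} (hy : 0 < y) (hR : 1 ≤ R) :
    R ^ (y - 1) * Real.exp (-R) ≤ Real.Gamma y := by
  have key : ∀ z : ℝ, 1 ≤ z → R ^ (z - 1) * Real.exp (-R) ≤ Real.Gamma z := by
    intro z hz
    have hconv := Real.GammaIntegral_convergent (zero_lt_one.trans_le hz)
    have hsub : Set.Ioi R ⊆ Set.Ioi 0 := Set.Ioi_subset_Ioi (by linarith)
    rw [Real.Gamma_eq_integral (by linarith), ← integral_exp_neg_Ioi R,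
      ← MeasureTheory.integral_const_mul]
    calc ∫ x in Set.Ioi R, R ^ (z - 1) * Real.exp (-x)
        ≤ ∫ x in Set.Ioi R, Real.exp (-x) * x ^ (z - 1) := by
          apply setIntegral_mono_on _ (hconv.mono_set hsub) measurableSet_Ioi
          · intro x hx
            rw [mul_comm]
            have := Real.rpow_le_rpow (by linarith) (le_of_lt hx) (sub_nonneg.2 hz)
            gcongr
          · exact (integrableOn_exp_neg_Ioi R).const_mul _
      _ ≤ ∫ x in Set.Ioi 0, Real.exp (-x) * x ^ (z - 1) := by
          apply setIntegral_mono_set hconv _ hsub.eventuallyLE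
          filter_upwards [ae_restrict_mem measurableSet_Ioi] with x hx
          exact mul_nonneg (Real.exp_nonneg _) (Real.rpow_nonneg (le_of_lt hx) _)
  rcases le_total 1 y with h | h
  · exact key y h
  · have h1 := key (y + 1) (by linarith)
    rw [Real.Gamma_add_one hy.ne'] at h1
    have h2 : R ^ (y - 1) ≤ R ^ (y + 1 - 1) := Real.rpow_le_rpow_of_exponent_le hR (by linarith)
    have h3 := mul_le_mul_of_nonneg_right h2 (Real.exp_nonneg (-R))
    nlinarith [Real.Gamma_pos_of_pos hy]

lemma rlKernel_le {a t R : ℝ} (ha : 0 < a) (ht : 0 < t) (hR : 1 ≤ R) :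
    rlKernel a t ≤ Real.exp R * (t / R) ^ (a - 1) := by
  have hR0 : 0 < R := by linarith
  have hpos : 0 < R ^ (a - 1) := Real.rpow_pos_of_pos hR0 _
  have h := inv_anti₀ (by positivity) (rpow_mul_exp_neg_le_Gamma ha hR)
  rw [mul_inv, Real.exp_neg, inv_inv] at h
  rw [rlKernel, Real.div_rpow ht.le hR0.le]
  calc t ^ (a - 1) * (Real.Gamma a)⁻¹ ≤ t ^ (a - 1) * ((R ^ (a - 1))⁻¹ * Real.exp R) := by gcongr
    _ = _ := by ring

lemma exists_mul_div_rpow_lt_one {α β : ℝ} (hα : 0 < α) (hβ : 0 < β) (t x y : ℝ) :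
    ∃ R : ℝ, 1 ≤ R ∧ x * (t / R) ^ α < 1 ∧ y * (t / R) ^ β < 1 := by
  have lim : ∀ {γ : ℝ}, 0 < γ → ∀ z : ℝ,
      ∀ᶠ R : ℝ in Filter.atTop, z * (t / R) ^ γ < 1 := by
    intro γ hγ z
    have h1 : Filter.Tendsto (fun R : ℝ => t / R) Filter.atTop (nhds 0) :=
      Filter.Tendsto.div_atTop tendsto_const_nhds Filter.tendsto_id
    have h2 := (h1.rpow_const (p := γ) (Or.inr hγ.le)).const_mul z
    rw [Real.zero_rpow hγ.ne', mul_zero] at h2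
    exact h2.eventually_lt_const one_pos
  obtain ⟨R, h⟩ := ((Filter.eventually_ge_atTop 1).and ((lim hα x).and (lim hβ y))).exists
  exact ⟨R, h⟩

lemma summable_pow_mul_pow_mul_rlKernel {α β c t x y : ℝ} (hα : 0 < α) (hβ : 0 < β)
    (hc : 0 < c) (ht : 0 < t) (hx : 0 ≤ x) (hy : 0 ≤ y) :
    Summable fun p : ℕ × ℕ => x ^ p.1 * y ^ p.2 * rlKernel (α * p.1 + β * p.2 + c) t := by
  obtain ⟨R, hR, hxR, hyR⟩ := exists_mul_div_rpow_lt_one hα hβ t x y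
  have hs : 0 < t / R := div_pos ht (by linarith)
  have hgeom := ((summable_geometric_of_lt_one (by positivity) hxR).mul_of_nonneg
    (summable_geometric_of_lt_one (by positivity) hyR)
    (fun n => by positivity) (fun n => by positivity)).mul_left
      (Real.exp R * (t / R) ^ (c - 1))
  have ha : ∀ p : ℕ × ℕ, 0 < α * p.1 + β * p.2 + c := fun p => by positivity
  refine hgeom.of_nonneg_of_le
    (fun p => mul_nonneg (by positivity) (rlKernel_pos (ha p) ht).le) fun p => ?_
  calc x ^ p.1 * y ^ p.2 * rlKernel (α * p.1 + β * p.2 + c) t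
      ≤ x ^ p.1 * y ^ p.2 * (Real.exp R * (t / R) ^ (α * p.1 + β * p.2 + c - 1)) := by
        gcongr; exact rlKernel_le (ha p) ht hR
    _ = _ := by
        rw [add_sub_assoc, Real.rpow_add hs, Real.rpow_add hs, Real.rpow_mul hs.le,
          Real.rpow_mul hs.le, Real.rpow_natCast, Real.rpow_natCast, mul_pow, mul_pow]
        ring

lemma summable_pow_mul_rlKernel {α c t x : ℝ} (hα : 0 < α) (hc : 0 < c) (ht : 0 < t)
    (hx : 0 ≤ x) : Summable fun n : ℕ => x ^ n * rlKernel (α * n + c) t := by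
  have h := (summable_pow_mul_pow_mul_rlKernel (x := x) hα one_pos hc ht hx
    zero_le_one).comp_injective (Prod.mk_left_injective 0)
  simpa [Function.comp_def] using h

lemma norm_pow_mul_rlKernel (z : ℂ) (n : ℕ) {a t : ℝ} (ha : 0 < a) (ht : 0 < t) :
    ‖z ^ n * (rlKernel a t : ℂ)‖ = ‖z‖ ^ n * rlKernel a t := by
  rw [norm_mul, norm_pow, Complex.norm_of_nonneg (rlKernel_pos ha ht).le]

lemma summable_norm_pow_mul_rlKernel {α c t : ℝ} (hα : 0 < α) (hc : 0 < c) (ht : 0 < t)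
    (z : ℂ) : Summable fun n : ℕ => ‖z ^ n * (rlKernel (α * n + c) t : ℂ)‖ := by
  refine (summable_pow_mul_rlKernel hα hc ht (norm_nonneg z)).congr fun n => ?_
  rw [norm_pow_mul_rlKernel z n (by positivity) ht]

lemma Pfun_eq_tsum_rlKernel (α w : ℝ) (z : ℂ) {t : ℝ} (ht : 0 < t) :
    Pfun α w z t = ∑' n : ℕ, z ^ n * (rlKernel (α * n + (w + 1)) t : ℂ) := by
  rw [Pfun, mlE, ← tsum_mul_left]
  refine tsum_congr fun n => ?_
  have hpow : t ^ (α * n + (w + 1) - 1) = t ^ w * (t ^ α) ^ n := by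
    rw [← Real.rpow_natCast, ← Real.rpow_mul ht.le, ← Real.rpow_add ht]
    congr 1; ring
  rw [rlKernel, hpow, Complex.Gamma_ofReal, mul_pow]
  push_cast
  ring

/-- The causal convolution of two `P` functions as an absolutely convergent double series. -/
lemma hasSum_conv_Pfun {α β w₁ w₂ : ℝ} (hα : 0 < α) (hβ : 0 < β)
    (hw₁ : -1 < w₁) (hw₂ : -1 < w₂) (lam sig : ℂ) {t : ℝ} (ht : 0 < t) :
    HasSum (fun p : ℕ × ℕ => lam ^ p.1 * sig ^ p.2 *
        (rlKernel (α * p.1 + β * p.2 + (w₁ + w₂ + 2)) t : ℂ))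
      (∫ τ in (0 : ℝ)..t, Pfun α w₁ lam (t - τ) * Pfun β w₂ sig τ) := by
  have ha : ∀ n : ℕ, 0 < α * n + (w₁ + 1) := fun n => by
    have : 0 ≤ α * n := by positivity
    linarith
  have hb : ∀ n : ℕ, 0 < β * n + (w₂ + 1) := fun n => by
    have : 0 ≤ β * n := by positivity
    linarith
  set F : ℕ × ℕ → ℝ → ℂ := fun p τ =>
    (lam ^ p.1 * (rlKernel (α * p.1 + (w₁ + 1)) (t - τ) : ℂ)) *
      (sig ^ p.2 * (rlKernel (β * p.2 + (w₂ + 1)) τ : ℂ)) with hF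
  have hF_eq : ∀ p τ, F p τ = lam ^ p.1 * sig ^ p.2 *
      ((rlKernel (α * p.1 + (w₁ + 1)) (t - τ) * rlKernel (β * p.2 + (w₂ + 1)) τ : ℝ) : ℂ) := by
    intro p τ
    simp only [hF]
    push_cast
    ring
  have hint : ∀ p : ℕ × ℕ, ∫ τ in Set.Ioo 0 t, rlKernel (α * p.1 + (w₁ + 1)) (t - τ) *
      rlKernel (β * p.2 + (w₂ + 1)) τ = rlKernel (α * p.1 + β * p.2 + (w₁ + w₂ + 2)) t := by
    intro p
    rw [← integral_Ioc_eq_integral_Ioo, ← intervalIntegral.integral_of_le ht.le,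
      integral_rlKernel_mul_rlKernel (ha _) (hb _) ht]
    congr 1; ring
  have hF_int : ∀ p, Integrable (F p) (volume.restrict (Set.Ioo 0 t)) := by
    intro p
    have h := (integrableOn_rlKernel_mul_rlKernel (ha p.1) (hb p.2) ht).ofReal (𝕜 := ℂ)
    exact (h.const_mul (lam ^ p.1 * sig ^ p.2)).congr
      (Filter.Eventually.of_forall fun τ => (hF_eq p τ).symm)
  have hF_norm : ∀ p : ℕ × ℕ, ∫ τ in Set.Ioo 0 t, ‖F p τ‖ =
      ‖lam‖ ^ p.1 * ‖sig‖ ^ p.2 * rlKernel (α * p.1 + β * p.2 + (w₁ + w₂ + 2)) t := by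
    intro p
    rw [← hint, ← MeasureTheory.integral_const_mul]
    refine setIntegral_congr_fun measurableSet_Ioo fun τ hτ => ?_
    rw [hF_eq, norm_mul, norm_mul, norm_pow, norm_pow, Complex.norm_of_nonneg]
    exact (mul_pos (rlKernel_pos (ha _) (sub_pos.2 hτ.2)) (rlKernel_pos (hb _) hτ.1)).le
  have hF_sum : Summable fun p => ∫ τ in Set.Ioo 0 t, ‖F p τ‖ := by
    simp_rw [hF_norm]
    exact summable_pow_mul_pow_mul_rlKernel hα hβ (by linarith) ht (norm_nonneg _) (norm_nonneg _)
  have h := hasSum_integral_of_summable_integral_norm hF_int hF_sum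
  have hval : ∫ τ in Set.Ioo 0 t, ∑' p, F p τ =
      ∫ τ in (0 : ℝ)..t, Pfun α w₁ lam (t - τ) * Pfun β w₂ sig τ := by
    rw [intervalIntegral.integral_of_le ht.le, integral_Ioc_eq_integral_Ioo]
    refine setIntegral_congr_fun measurableSet_Ioo fun τ hτ => ?_
    have hτ' : 0 < t - τ := sub_pos.2 hτ.2
    rw [Pfun_eq_tsum_rlKernel _ _ _ hτ', Pfun_eq_tsum_rlKernel _ _ _ hτ.1,
      tsum_mul_tsum_of_summable_norm
        (summable_norm_pow_mul_rlKernel hα (by linarith) hτ' lam)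
        (summable_norm_pow_mul_rlKernel hβ (by linarith) hτ.1 sig)]
  rw [hval] at h
  refine h.congr_fun fun p => ?_
  simp_rw [hF_eq]
  rw [MeasureTheory.integral_const_mul, integral_complex_ofReal, hint]

/-- Convolution-to-series identity for `P` functions: for `α, β > 0`,
`w₁, w₂ > -1`, `w = w₁ + w₂` and `t > 0`, the causal convolution of
`P_{α,w₁}(λ,·)` and `P_{β,w₂}(σ,·)` equals both convergent series
`∑_k σ^k P_{α,w+βk+1}(λ,t)` and `∑_j λ^j P_{β,w+αj+1}(σ,t)`. -/
theorem conv_Pfun_to_series (α β w₁ w₂ : ℝ) (hα : 0 < α) (hβ : 0 < β)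
    (hw₁ : -1 < w₁) (hw₂ : -1 < w₂) (lam sig : ℂ) (t : ℝ) (ht : 0 < t) :
    Summable (fun k : ℕ => sig ^ k * Pfun α ((w₁ + w₂) + β * (k : ℝ) + 1) lam t) ∧
    Summable (fun j : ℕ => lam ^ j * Pfun β ((w₁ + w₂) + α * (j : ℝ) + 1) sig t) ∧
    ((∫ τ in (0 : ℝ)..t, Pfun α w₁ lam (t - τ) * Pfun β w₂ sig τ) =
      ∑' k : ℕ, sig ^ k * Pfun α ((w₁ + w₂) + β * (k : ℝ) + 1) lam t) ∧
    ((∫ τ in (0 : ℝ)..t, Pfun α w₁ lam (t - τ) * Pfun β w₂ sig τ) =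
      ∑' j : ℕ, lam ^ j * Pfun β ((w₁ + w₂) + α * (j : ℝ) + 1) sig t) := by
  have h := hasSum_conv_Pfun hα hβ hw₁ hw₂ lam sig ht
  have h_swap := h.summable.prod_symm
  have hk : ∀ k : ℕ, sig ^ k * Pfun α ((w₁ + w₂) + β * (k : ℝ) + 1) lam t =
      ∑' n : ℕ, lam ^ n * sig ^ k * (rlKernel (α * n + β * k + (w₁ + w₂ + 2)) t : ℂ) := by
    intro k
    rw [Pfun_eq_tsum_rlKernel _ _ _ ht, ← tsum_mul_left]
    refine tsum_congr fun n => ?_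
    rw [show α * n + (w₁ + w₂ + β * k + 1 + 1) = α * n + β * k + (w₁ + w₂ + 2) by ring]
    ring
  have hj : ∀ j : ℕ, lam ^ j * Pfun β ((w₁ + w₂) + α * (j : ℝ) + 1) sig t =
      ∑' n : ℕ, lam ^ j * sig ^ n * (rlKernel (α * j + β * n + (w₁ + w₂ + 2)) t : ℂ) := by
    intro j
    rw [Pfun_eq_tsum_rlKernel _ _ _ ht, ← tsum_mul_left]
    refine tsum_congr fun n => ?_
    rw [show β * n + (w₁ + w₂ + α * j + 1 + 1) = α * j + β * n + (w₁ + w₂ + 2) by ring]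
    ring
  simp_rw [hk, hj, ← h.tsum_eq]
  refine ⟨h_swap.prod, h.summable.prod, ?_, h.summable.tsum_prod⟩
  rw [h.summable.tsum_prod]
  exact h_swap.tsum_comm
end

section
/- Let α > 0, v₁, v₂ < α, λ, σ ∈ ℂ with λ ≠ σ, and set v = v₁ + v₂. Then for every t > 0, ∫_0^t R_{α,v₁}(λ,t−τ) R_{α,v₂}(σ,τ) dτ = (1/(λ−σ)) · ( λ R_{α, v−α}(λ,t) − σ R_{α, v−α}(σ,t) ). -/
open MeasureTheory

theorem integral_sub_rpow_mul_rpow {p q t : ℝ} (hp : 0 < p) (hq : 0 < q) (ht : 0 < t) :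
    ∫ τ in (0 : ℝ)..t, (t - τ) ^ (p - 1) * τ ^ (q - 1) =
      t ^ (p + q - 1) * (Real.Gamma p * Real.Gamma q / Real.Gamma (p + q)) := by
  have h := Complex.betaIntegral_scaled (q : ℂ) (p : ℂ) ht
  rw [Complex.betaIntegral_eq_Gamma_mul_div _ _ (by simpa) (by simpa)] at h
  apply Complex.ofReal_injective
  rw [← intervalIntegral.integral_ofReal]
  push_cast [Complex.ofReal_cpow ht.le]
  simp only [← Complex.Gamma_ofReal]
  push_cast
  rw [add_comm (p : ℂ) q, mul_comm (Complex.Gamma p), ← h]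
  refine intervalIntegral.integral_congr fun τ hτ => ?_
  rw [Set.uIcc_of_le ht.le] at hτ
  rw [Complex.ofReal_cpow hτ.1, Complex.ofReal_cpow (sub_nonneg.2 hτ.2)]
  push_cast
  ring

theorem intervalIntegrable_sub_rpow_mul_rpow {p q t : ℝ} (hp : 0 < p) (hq : 0 < q)
    (ht : 0 < t) :
    IntervalIntegrable (fun τ => (t - τ) ^ (p - 1) * τ ^ (q - 1)) volume 0 t := by
  by_contra h
  have h0 := intervalIntegral.integral_undef h
  rw [integral_sub_rpow_mul_rpow hp hq ht] at h0
  have := Real.Gamma_pos_of_pos hp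
  have := Real.Gamma_pos_of_pos hq
  have := Real.Gamma_pos_of_pos (add_pos hp hq)
  have : 0 < t ^ (p + q - 1) * (Real.Gamma p * Real.Gamma q / Real.Gamma (p + q)) := by
    positivity
  exact this.ne' h0

/-- The reciprocal Gamma function decays faster than any exponential. -/
theorem inv_Gamma_le {s X : ℝ} (hs : 0 < s) (hX : 0 < X) :
    (Real.Gamma s)⁻¹ ≤ (X + 1) * Real.exp (X + 1) * (X ^ s)⁻¹ := by
  have hXs : 0 < X ^ s := Real.rpow_pos_of_pos hX s
  have key : Real.exp (-(X + 1)) * (X ^ s / (X + 1)) ≤ Real.Gamma s := by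
    rw [Real.Gamma_eq_integral hs]
    have hint := Real.GammaIntegral_convergent hs
    have hsub : Set.Ioc X (X + 1) ⊆ Set.Ioi 0 := fun x hx => hX.trans hx.1
    calc Real.exp (-(X + 1)) * (X ^ s / (X + 1))
        = ∫ _ in Set.Ioc X (X + 1), Real.exp (-(X + 1)) * (X ^ s / (X + 1)) := by simp
      _ ≤ ∫ x in Set.Ioc X (X + 1), Real.exp (-x) * x ^ (s - 1) := by
          refine setIntegral_mono_on (integrableOn_const (by simp)) (hint.mono_set hsub)
            measurableSet_Ioc ?_
          intro x hx
          have hx0 : 0 < x := hsub hx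
          rw [Real.rpow_sub_one hx0.ne']
          have h1 := hx.1.le
          have h2 := hx.2
          gcongr
      _ ≤ ∫ x in Set.Ioi 0, Real.exp (-x) * x ^ (s - 1) := by
          refine setIntegral_mono_set hint ?_ hsub.eventuallyLE
          filter_upwards [ae_restrict_mem measurableSet_Ioi] with x hx
          have hx0 : (0 : ℝ) < x := hx
          simp only [Pi.zero_apply]
          positivity
  calc (Real.Gamma s)⁻¹ ≤ (Real.exp (-(X + 1)) * (X ^ s / (X + 1)))⁻¹ := by
        gcongr
    _ = _ := by
        rw [Real.exp_neg]
        field_simp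

theorem exists_inv_Gamma_le_geometric {α β : ℝ} (hα : 0 < α) (hβ : 0 < β) {M : ℝ}
    (hM : 0 < M) :
    ∃ C : ℝ, ∀ n : ℕ, (Real.Gamma (α * n + β))⁻¹ ≤ C * (M⁻¹) ^ n := by
  have hX : 0 < M ^ α⁻¹ := Real.rpow_pos_of_pos hM _
  refine ⟨(M ^ α⁻¹ + 1) * Real.exp (M ^ α⁻¹ + 1) * ((M ^ α⁻¹) ^ β)⁻¹, fun n => ?_⟩
  refine (inv_Gamma_le (by positivity) hX).trans_eq ?_
  rw [Real.rpow_add hX, Real.rpow_mul hX.le, ← Real.rpow_mul hM.le, inv_mul_cancel₀ hα.ne',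
    Real.rpow_one, Real.rpow_natCast, mul_inv, inv_pow]
  ring

theorem hasSum_mlE {α β : ℝ} (hα : 0 < α) (hβ : 0 < β) (z : ℂ) :
    HasSum (fun n : ℕ => z ^ n * (Complex.Gamma ((α * n + β : ℝ) : ℂ))⁻¹) (mlE α β z) := by
  apply Summable.hasSum
  obtain ⟨C, hC⟩ := exists_inv_Gamma_le_geometric hα hβ (M := ‖z‖ + 1) (by positivity)
  have hlt : ‖z‖ * (‖z‖ + 1)⁻¹ < 1 := by
    rw [← div_eq_mul_inv, div_lt_one (by positivity)]
    linarith
  refine Summable.of_norm_bounded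
    ((summable_geometric_of_lt_one (by positivity) hlt).mul_left C) fun n => ?_
  have hpos : 0 < Real.Gamma (α * n + β) := Real.Gamma_pos_of_pos (by positivity)
  rw [Complex.Gamma_ofReal, norm_mul, norm_pow, norm_inv, Complex.norm_of_nonneg hpos.le,
    mul_pow]
  calc _ ≤ ‖z‖ ^ n * (C * (‖z‖ + 1)⁻¹ ^ n) := by gcongr; exact hC n
    _ = _ := by ring

theorem hasSum_Rfun {α v t : ℝ} (hα : 0 < α) (hv : v < α) (ht : 0 < t) (lam : ℂ) :
    HasSum (fun n : ℕ => lam ^ n *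
      ((t ^ (α * n + (α - v) - 1) / Real.Gamma (α * n + (α - v)) : ℝ) : ℂ))
      (Rfun α v lam t) := by
  have h := (hasSum_mlE hα (sub_pos.2 hv) (lam * ((t ^ α : ℝ) : ℂ))).mul_left
    ((t ^ (α - v - 1) : ℝ) : ℂ)
  refine h.congr_fun fun n => ?_
  rw [add_sub_assoc, Real.rpow_add ht, Real.rpow_mul ht.le, Real.rpow_natCast,
    Complex.Gamma_ofReal]
  push_cast
  ring

/-- Regrouping along antidiagonals turns a double power series whose coefficients depend only on
`m + n` into a difference of two power series. -/
theorem tsum_prod_pow_mul_pow {x y : ℂ} (hxy : x ≠ y) {g : ℕ → ℂ} {a b : ℂ}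
    (hs : Summable fun k : ℕ × ℕ => x ^ k.1 * y ^ k.2 * g (k.1 + k.2))
    (hx : HasSum (fun n => x ^ n * g n) a) (hy : HasSum (fun n => y ^ n * g n) b) :
    ∑' k : ℕ × ℕ, x ^ k.1 * y ^ k.2 * g (k.1 + k.2) = 1 / (x - y) * (x * a - y * b) := by
  have hsum := (Finset.HasAntidiagonal.sigmaAntidiagonalEquivProd.hasSum_iff.2 hs.hasSum).sigma
    fun n => hasSum_fintype _
  refine hsum.unique ?_
  refine (((hx.mul_left x).sub (hy.mul_left y)).mul_left (1 / (x - y))).congr_fun fun n => ?_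
  have hg := Commute.geom_sum₂_mul (Commute.all x y) (n + 1)
  have hne := sub_ne_zero.2 hxy
  simp only [Function.comp_apply, Finset.HasAntidiagonal.sigmaAntidiagonalEquivProd_apply]
  rw [Finset.sum_coe_sort (Finset.HasAntidiagonal.antidiagonal n)
    (fun k : ℕ × ℕ => x ^ k.1 * y ^ k.2 * g (k.1 + k.2)),
    Finset.Nat.sum_antidiagonal_eq_sum_range_succ_mk]
  have hr : ∀ k ∈ Finset.range n.succ, x ^ k * y ^ (n - k) * g (k + (n - k)) =
      x ^ k * y ^ (n + 1 - 1 - k) * g n := fun k hk => by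
    rw [Nat.add_sub_cancel, Nat.add_sub_cancel' (Nat.lt_succ_iff.1 (Finset.mem_range.1 hk))]
  rw [Finset.sum_congr rfl hr, ← Finset.sum_mul, Nat.succ_eq_add_one]
  field_simp
  linear_combination g n * hg

theorem summable_pow_mul_pow_div_Gamma {α β t : ℝ} (hα : 0 < α) (hβ : 0 < β) (ht : 0 < t)
    {x y : ℝ} (hx : 0 ≤ x) (hy : 0 ≤ y) :
    Summable fun k : ℕ × ℕ => x ^ k.1 * y ^ k.2 *
      (t ^ (α * (k.1 + k.2 : ℕ) + β - 1) / Real.Gamma (α * (k.1 + k.2 : ℕ) + β)) := by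
  have hT : 0 < t ^ α := Real.rpow_pos_of_pos ht α
  set M : ℝ := (x + y + 1) * t ^ α with hM
  have hM0 : 0 < M := by positivity
  obtain ⟨C, hC⟩ := exists_inv_Gamma_le_geometric hα hβ hM0
  have hsx : Summable fun n : ℕ => (x / (x + y + 1)) ^ n :=
    summable_geometric_of_lt_one (by positivity) (by rw [div_lt_one (by positivity)]; linarith)
  have hsy : Summable fun n : ℕ => (y / (x + y + 1)) ^ n :=
    summable_geometric_of_lt_one (by positivity) (by rw [div_lt_one (by positivity)]; linarith)
  have hprod := (hsx.mul_of_nonneg hsy (fun n => by positivity)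
    (fun n => by positivity)).mul_left (C * t ^ (β - 1))
  refine Summable.of_nonneg_of_le (fun k => ?_) (fun k => ?_) hprod
  · have := Real.Gamma_pos_of_pos (show 0 < α * (k.1 + k.2 : ℕ) + β by positivity)
    positivity
  · calc _ ≤ x ^ k.1 * y ^ k.2 * (t ^ (α * (k.1 + k.2 : ℕ) + β - 1) *
          (C * M⁻¹ ^ (k.1 + k.2))) := by
          rw [div_eq_mul_inv]
          gcongr
          exact hC _
      _ = _ := by
          rw [add_sub_assoc, Real.rpow_add ht, Real.rpow_mul ht.le, Real.rpow_natCast, hM]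
          simp only [pow_add, div_pow, mul_inv, inv_pow, mul_pow]
          field_simp

/-- Same-order convolution identity for `R` functions with distinct
eigenvalues: for `α > 0`, `v₁, v₂ < α`, `λ ≠ σ`, `v = v₁ + v₂` and `t > 0`,
`(R_{α,v₁}(λ,·) * R_{α,v₂}(σ,·))(t) = (λ R_{α,v-α}(λ,t) - σ R_{α,v-α}(σ,t))/(λ-σ)`. -/
theorem conv_Rfun_same_order (α v₁ v₂ : ℝ) (hα : 0 < α) (hv₁ : v₁ < α) (hv₂ : v₂ < α)
    (lam sig : ℂ) (hls : lam ≠ sig) (t : ℝ) (ht : 0 < t) :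
    (∫ τ in (0 : ℝ)..t, Rfun α v₁ lam (t - τ) * Rfun α v₂ sig τ) =
      (1 / (lam - sig)) *
        (lam * Rfun α ((v₁ + v₂) - α) lam t - sig * Rfun α ((v₁ + v₂) - α) sig t) := by
  have ha : 0 < α - v₁ := sub_pos.2 hv₁
  have hb : 0 < α - v₂ := sub_pos.2 hv₂
  have hβ : 0 < α - (v₁ + v₂ - α) := by linarith
  set c : ℕ × ℕ → ℂ := fun k => lam ^ k.1 * sig ^ k.2 *
    (((Real.Gamma (α * k.1 + (α - v₁)) * Real.Gamma (α * k.2 + (α - v₂)))⁻¹ : ℝ) : ℂ) with hc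
  set f : ℕ × ℕ → ℝ → ℝ := fun k τ =>
    (t - τ) ^ (α * k.1 + (α - v₁) - 1) * τ ^ (α * k.2 + (α - v₂) - 1) with hf
  set g : ℕ → ℝ := fun n => t ^ (α * n + (α - (v₁ + v₂ - α)) - 1) /
    Real.Gamma (α * n + (α - (v₁ + v₂ - α))) with hg
  have hp : ∀ n : ℕ, 0 < α * n + (α - v₁) := fun n => by positivity
  have hq : ∀ n : ℕ, 0 < α * n + (α - v₂) := fun n => by positivity
  have hfint : ∀ k, Integrable (f k) (volume.restrict (Set.Ioc 0 t)) := fun k =>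
    (intervalIntegrable_iff_integrableOn_Ioc_of_le ht.le).1
      (intervalIntegrable_sub_rpow_mul_rpow (hp k.1) (hq k.2) ht)
  have hfval : ∀ k, ∫ τ in Set.Ioc 0 t, f k τ = Real.Gamma (α * k.1 + (α - v₁)) *
      Real.Gamma (α * k.2 + (α - v₂)) * g (k.1 + k.2) := fun k => by
    rw [← intervalIntegral.integral_of_le ht.le,
      integral_sub_rpow_mul_rpow (hp k.1) (hq k.2) ht]
    have he : α * k.1 + (α - v₁) + (α * k.2 + (α - v₂)) =
      α * (k.1 + k.2 : ℕ) + (α - (v₁ + v₂ - α)) := by push_cast; ring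
    rw [he, hg]
    ring
  have hG : ∀ k : ℕ × ℕ, 0 < Real.Gamma (α * k.1 + (α - v₁)) *
      Real.Gamma (α * k.2 + (α - v₂)) := fun k =>
    mul_pos (Real.Gamma_pos_of_pos (hp _)) (Real.Gamma_pos_of_pos (hq _))
  have hnorm : ∀ k, ∫ τ in Set.Ioc 0 t, ‖c k * (f k τ : ℂ)‖ =
      ‖lam‖ ^ k.1 * ‖sig‖ ^ k.2 * g (k.1 + k.2) := fun k => by
    have h1 : ∫ τ in Set.Ioc 0 t, ‖c k * (f k τ : ℂ)‖ = ∫ τ in Set.Ioc 0 t, ‖c k‖ * f k τ := by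
      refine setIntegral_congr_fun measurableSet_Ioc fun τ hτ => ?_
      have h0 : 0 ≤ f k τ :=
        mul_nonneg (Real.rpow_nonneg (sub_nonneg.2 hτ.2) _) (Real.rpow_nonneg hτ.1.le _)
      simp only [norm_mul, Complex.norm_of_nonneg h0]
    rw [h1, integral_const_mul, hfval]
    simp only [hc, norm_mul, norm_pow, Complex.norm_of_nonneg (inv_pos.2 (hG k)).le]
    have := (hG k).ne'
    field_simp
  have hval : ∀ k, ∫ τ in Set.Ioc 0 t, c k * (f k τ : ℂ) =
      lam ^ k.1 * sig ^ k.2 * (g (k.1 + k.2) : ℂ) := fun k => by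
    rw [integral_const_mul, integral_complex_ofReal, hfval]
    have h2 : (((Real.Gamma (α * k.1 + (α - v₁)) *
      Real.Gamma (α * k.2 + (α - v₂)) : ℝ)) : ℂ) ≠ 0 := Complex.ofReal_ne_zero.2 (hG k).ne'
    simp only [hc]
    rw [Complex.ofReal_mul (_ * _) (g _), Complex.ofReal_inv]
    field_simp
  have hsummable := summable_pow_mul_pow_div_Gamma hα hβ ht (norm_nonneg lam) (norm_nonneg sig)
  have hsum := hasSum_integral_of_summable_integral_norm
    (F := fun k τ => c k * (f k τ : ℂ)) (μ := volume.restrict (Set.Ioc 0 t))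
    (fun k => (hfint k).ofReal.const_mul (c k))
    (hsummable.congr fun k => (hnorm k).symm)
  simp only [hval] at hsum
  rw [← tsum_prod_pow_mul_pow (g := fun n => (g n : ℂ)) hls hsum.summable
    (hasSum_Rfun hα (by linarith) ht lam) (hasSum_Rfun hα (by linarith) ht sig), hsum.tsum_eq,
    intervalIntegral.integral_of_le ht.le, integral_Ioc_eq_integral_Ioo,
    integral_Ioc_eq_integral_Ioo]
  refine setIntegral_congr_fun measurableSet_Ioo fun τ hτ => ?_
  have h1 := hasSum_Rfun hα hv₁ (sub_pos.2 hτ.2) lam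
  have h2 := hasSum_Rfun hα hv₂ hτ.1 sig
  rw [← h1.tsum_eq, ← h2.tsum_eq, tsum_mul_tsum_of_summable_norm h1.summable.norm
    h2.summable.norm]
  refine tsum_congr fun k => ?_
  simp only [hc, hf]
  push_cast
  rw [mul_inv]
  ring
end

section
/- Let α > 0, w₁, w₂ > −1, λ, σ ∈ ℂ with λ ≠ σ, and set w = w₁ + w₂. Then for every t > 0, ∫_0^t P_{α,w₁}(λ,t−τ) P_{α,w₂}(σ,τ) dτ = (1/(λ−σ)) · ( λ P_{α, w+1}(λ,t) − σ P_{α, w+1}(σ,t) ). Equivalently, in Mittag-Leffler form: t^{w₁}E_{α,w₁+1}(λt^α) * t^{w₂}E_{α,w₂+1}(σt^α) = (t^{w+1}/(λ−σ)) ( λ E_{α,w+2}(λ t^α) − σ E_{α,w+2}(σ t^α) ). -/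
open MeasureTheory

/-- A lower bound for `Γ` with arbitrary exponential growth rate. -/
theorem rpow_mul_exp_le_Gamma {s R : ℝ} (hs : 1 ≤ s) (hR : 0 < R) :
    R ^ (s - 1) * Real.exp (-(R + 1)) ≤ Real.Gamma s := by
  have hint := Real.GammaIntegral_convergent (zero_lt_one.trans_le hs)
  have hsub : Set.Ioc R (R + 1) ⊆ Set.Ioi 0 := fun x hx => hR.trans hx.1
  rw [Real.Gamma_eq_integral (zero_lt_one.trans_le hs)]
  calc R ^ (s - 1) * Real.exp (-(R + 1))
      = ∫ _ in Set.Ioc R (R + 1), R ^ (s - 1) * Real.exp (-(R + 1)) := by simp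
    _ ≤ ∫ x in Set.Ioc R (R + 1), Real.exp (-x) * x ^ (s - 1) := by
      refine setIntegral_mono_on (integrableOn_const (by simp)) (hint.mono_set hsub)
        measurableSet_Ioc fun x hx => ?_
      rw [mul_comm]
      have h1 : Real.exp (-(R + 1)) ≤ Real.exp (-x) := Real.exp_le_exp.2 (by linarith [hx.2])
      have h2 : R ^ (s - 1) ≤ x ^ (s - 1) :=
        Real.rpow_le_rpow hR.le hx.1.le (by linarith)
      exact mul_le_mul h1 h2 (by positivity) (by positivity)
    _ ≤ ∫ x in Set.Ioi 0, Real.exp (-x) * x ^ (s - 1) := by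
      refine setIntegral_mono_set hint ?_ hsub.eventuallyLE
      refine ae_restrict_of_forall_mem measurableSet_Ioi fun x hx => ?_
      have : (0 : ℝ) < x := hx
      positivity

/-- The Mittag-Leffler series converges absolutely. -/
theorem summable_pow_mul_inv_Gamma {α : ℝ} (hα : 0 < α) (β : ℝ) {x : ℝ} (hx : 0 ≤ x) :
    Summable fun n : ℕ => x ^ n * (Real.Gamma (α * n + β))⁻¹ := by
  set R : ℝ := (2 * x + 1) ^ α⁻¹ with hRdef
  have hR : 0 < R := by positivity
  have hRα : R ^ α = 2 * x + 1 := Real.rpow_inv_rpow (by positivity) hα.ne'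
  have hq : x / (2 * x + 1) < 1 := (div_lt_one (by positivity)).2 (by linarith)
  have hg : Summable fun n : ℕ =>
      (x / (2 * x + 1)) ^ n * (R ^ (1 - β) * Real.exp (R + 1)) :=
    (summable_geometric_of_lt_one (by positivity) hq).mul_right _
  refine Summable.of_norm_bounded_eventually_nat hg ?_
  have htend : Filter.Tendsto (fun n : ℕ => α * (n : ℝ)) Filter.atTop Filter.atTop :=
    tendsto_natCast_atTop_atTop.const_mul_atTop hα
  filter_upwards [htend.eventually_ge_atTop (1 - β)] with n hn
  have hs : 1 ≤ α * n + β := by linarith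
  have hΓ := rpow_mul_exp_le_Gamma hs hR
  have hΓpos : 0 < Real.Gamma (α * n + β) := Real.Gamma_pos_of_pos (by linarith)
  rw [Real.norm_of_nonneg (by positivity), div_pow, div_eq_mul_inv, mul_assoc]
  refine mul_le_mul_of_nonneg_left ?_ (by positivity)
  refine (inv_anti₀ (by positivity) hΓ).trans_eq ?_
  rw [show α * n + β - 1 = α * n - (1 - β) by ring, Real.rpow_sub hR, Real.rpow_mul hR.le, hRα,
    Real.rpow_natCast, Real.exp_neg]
  field_simp

/-- The normalized power `t ^ w / Γ (w + 1)`, the kernel of fractional integration. -/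
noncomputable def powGamma (w t : ℝ) : ℝ := t ^ w / Real.Gamma (w + 1)

theorem summable_pow_mul_powGamma {α : ℝ} (hα : 0 < α) (w : ℝ) {t : ℝ} (ht : 0 < t) {x : ℝ}
    (hx : 0 ≤ x) : Summable fun n : ℕ => x ^ n * powGamma (α * n + w) t := by
  have h := (summable_pow_mul_inv_Gamma hα (w + 1) (x := x * t ^ α) (by positivity)).mul_left
    (t ^ w)
  refine h.congr fun n => ?_
  rw [powGamma, Real.rpow_add ht, Real.rpow_mul ht.le, Real.rpow_natCast, ← add_assoc, mul_pow]
  ring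

theorem powGamma_nonneg {w t : ℝ} (hw : -1 < w) (ht : 0 ≤ t) : 0 ≤ powGamma w t :=
  div_nonneg (Real.rpow_nonneg ht _) (Real.Gamma_pos_of_pos (by linarith)).le

theorem norm_pow_mul_powGamma (α w : ℝ) {t : ℝ} (lam : ℂ) (n : ℕ)
    (h : 0 ≤ powGamma (α * n + w) t) :
    ‖lam ^ n * (powGamma (α * n + w) t : ℂ)‖ = ‖lam‖ ^ n * powGamma (α * n + w) t := by
  rw [norm_mul, norm_pow, Complex.norm_real, Real.norm_of_nonneg h]

theorem neg_one_lt_mul_natCast_add {α w : ℝ} (hα : 0 < α) (hw : -1 < w) (n : ℕ) :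
    -1 < α * n + w := by
  have : 0 ≤ α * n := by positivity
  linarith

theorem summable_norm_pow_mul_powGamma {α w : ℝ} (hα : 0 < α) (hw : -1 < w) (lam : ℂ) {t : ℝ}
    (ht : 0 < t) : Summable fun n : ℕ => ‖lam ^ n * (powGamma (α * n + w) t : ℂ)‖ :=
  (summable_pow_mul_powGamma hα w ht (norm_nonneg lam)).congr fun n =>
    (norm_pow_mul_powGamma α w lam n
      (powGamma_nonneg (neg_one_lt_mul_natCast_add hα hw n) ht.le)).symm

theorem Pfun_eq_tsum (α w : ℝ) (lam : ℂ) {t : ℝ} (ht : 0 < t) :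
    Pfun α w lam t = ∑' n : ℕ, lam ^ n * (powGamma (α * n + w) t : ℂ) := by
  rw [Pfun, mlE, ← tsum_mul_left]
  refine tsum_congr fun n => ?_
  rw [powGamma, Real.rpow_add ht, Real.rpow_mul ht.le, Real.rpow_natCast, ← add_assoc, mul_pow,
    Complex.Gamma_ofReal]
  push_cast
  ring

theorem hasSum_Pfun {α w : ℝ} (hα : 0 < α) (hw : -1 < w) (lam : ℂ) {t : ℝ} (ht : 0 < t) :
    HasSum (fun n : ℕ => lam ^ n * (powGamma (α * n + w) t : ℂ)) (Pfun α w lam t) := by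
  rw [Pfun_eq_tsum α w lam ht]
  exact (summable_norm_pow_mul_powGamma hα hw lam ht).of_norm.hasSum

/-- The Euler beta integral as a convolution identity. -/
theorem integral_powGamma_mul {a b t : ℝ} (ha : -1 < a) (hb : -1 < b) (ht : 0 < t) :
    ∫ τ in Set.Ioo 0 t, powGamma a (t - τ) * powGamma b τ = powGamma (a + b + 1) t := by
  have hA : 0 < Real.Gamma (a + 1) := Real.Gamma_pos_of_pos (by linarith)
  have hB : 0 < Real.Gamma (b + 1) := Real.Gamma_pos_of_pos (by linarith)
  have hC : 0 < Real.Gamma (b + 1 + (a + 1)) := Real.Gamma_pos_of_pos (by linarith)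
  have key : ∫ τ in Set.Ioo 0 t, (t - τ) ^ a * τ ^ b =
      t ^ (a + b + 1) * (Real.Gamma (b + 1) * Real.Gamma (a + 1) /
        Real.Gamma (b + 1 + (a + 1))) := by
    have h1 := Complex.betaIntegral_scaled ((b + 1 : ℝ) : ℂ) ((a + 1 : ℝ) : ℂ) ht
    have h2 := Complex.Gamma_mul_Gamma_eq_betaIntegral (s := ((b + 1 : ℝ) : ℂ))
      (t := ((a + 1 : ℝ) : ℂ)) (by rw [Complex.ofReal_re]; linarith)
      (by rw [Complex.ofReal_re]; linarith)
    rw [← Complex.ofReal_add, Complex.Gamma_ofReal, Complex.Gamma_ofReal,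
      Complex.Gamma_ofReal] at h2
    have h3 : Complex.betaIntegral ((b + 1 : ℝ) : ℂ) ((a + 1 : ℝ) : ℂ) =
        ((Real.Gamma (b + 1) * Real.Gamma (a + 1) / Real.Gamma (b + 1 + (a + 1)) : ℝ) : ℂ) := by
      have : (Real.Gamma (b + 1 + (a + 1)) : ℂ) ≠ 0 := Complex.ofReal_ne_zero.2 hC.ne'
      push_cast at h2 ⊢
      rw [h2]
      field_simp
    have h4 : (t : ℂ) ^ (((b + 1 : ℝ) : ℂ) + ((a + 1 : ℝ) : ℂ) - 1) =
        ((t ^ (a + b + 1) : ℝ) : ℂ) := by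
      rw [Complex.ofReal_cpow ht.le]
      congr 1
      push_cast
      ring
    rw [h3, h4, intervalIntegral.integral_of_le ht.le, integral_Ioc_eq_integral_Ioo] at h1
    apply Complex.ofReal_injective
    rw [← integral_complex_ofReal, Complex.ofReal_mul, ← h1]
    refine setIntegral_congr_fun measurableSet_Ioo fun τ hτ => ?_
    have e1 : 0 ≤ t - τ := by linarith [hτ.2]
    rw [mul_comm, Complex.ofReal_mul, Complex.ofReal_cpow hτ.1.le, Complex.ofReal_cpow e1]
    push_cast
    simp
  have h5 : ∀ τ : ℝ, powGamma a (t - τ) * powGamma b τ =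
      (Real.Gamma (a + 1) * Real.Gamma (b + 1))⁻¹ * ((t - τ) ^ a * τ ^ b) := fun τ => by
    rw [powGamma, powGamma]
    field_simp
  simp_rw [h5]
  rw [integral_const_mul, key, powGamma, show a + b + 1 + 1 = b + 1 + (a + 1) by ring]
  field_simp

theorem integrableOn_powGamma_mul {a b t : ℝ} (ha : -1 < a) (hb : -1 < b) (ht : 0 < t) :
    IntegrableOn (fun τ => powGamma a (t - τ) * powGamma b τ) (Set.Ioo 0 t) := by
  refine Integrable.of_integral_ne_zero ?_
  rw [integral_powGamma_mul ha hb ht]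
  exact (div_pos (Real.rpow_pos_of_pos ht _) (Real.Gamma_pos_of_pos (by linarith))).ne'

/-- Grouping a double series of Cauchy-product type by total degree: summability. -/
theorem summable_pow_mul_pow_mul {x y : ℝ} (hx : 0 ≤ x) (hy : 0 ≤ y) {g : ℕ → ℝ}
    (hg : ∀ k, 0 ≤ g k) (hsum : ∀ z : ℝ, 0 ≤ z → Summable fun k => z ^ k * g k) :
    Summable fun p : ℕ × ℕ => x ^ p.1 * y ^ p.2 * g (p.1 + p.2) := by
  rw [← Finset.HasAntidiagonal.sigmaAntidiagonalEquivProd.summable_iff,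
    summable_sigma_of_nonneg fun p => by exact mul_nonneg (by positivity) (hg _)]
  refine ⟨fun k => (hasSum_fintype _).summable, ?_⟩
  set M := max x y
  have hM : 0 ≤ M := hx.trans (le_max_left _ _)
  refine Summable.of_nonneg_of_le (fun k => tsum_nonneg fun p => ?_) (fun k => ?_)
    (hsum (2 * M) (by positivity))
  · exact mul_nonneg (by positivity) (hg _)
  · rw [tsum_fintype]
    calc _ ≤ ∑ _p : Finset.HasAntidiagonal.antidiagonal k, M ^ k * g k := by
          refine Finset.sum_le_sum fun p _ => ?_
          have hp : (p : ℕ × ℕ).1 + (p : ℕ × ℕ).2 = k :=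
            Finset.HasAntidiagonal.mem_antidiagonal.1 p.2
          simp only [Function.comp, Finset.HasAntidiagonal.sigmaAntidiagonalEquivProd_apply]
          rw [hp]
          refine mul_le_mul_of_nonneg_right ?_ (hg k)
          rw [show M ^ k = M ^ (p : ℕ × ℕ).1 * M ^ (p : ℕ × ℕ).2 by rw [← pow_add, hp]]
          exact mul_le_mul (pow_le_pow_left₀ hx (le_max_left _ _) _)
            (pow_le_pow_left₀ hy (le_max_right _ _) _) (by positivity) (by positivity)
      _ = (k + 1) * (M ^ k * g k) := by simp
      _ ≤ 2 ^ k * (M ^ k * g k) := by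
          refine mul_le_mul_of_nonneg_right ?_ (mul_nonneg (by positivity) (hg k))
          exact_mod_cast Nat.lt_two_pow_self
      _ = (2 * M) ^ k * g k := by rw [mul_pow]; ring

/-- Grouping a double series of Cauchy-product type by total degree: value. -/
theorem HasSum.pow_mul_pow_antidiagonal {x y S : ℂ} (hxy : x ≠ y) {g : ℕ → ℂ}
    (h : HasSum (fun p : ℕ × ℕ => x ^ p.1 * y ^ p.2 * g (p.1 + p.2)) S) :
    HasSum (fun k => 1 / (x - y) * (x * (x ^ k * g k) - y * (y ^ k * g k))) S := by
  rw [← Finset.HasAntidiagonal.sigmaAntidiagonalEquivProd.hasSum_iff] at h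
  convert! h.sigma fun k => hasSum_fintype _ using 2 with k
  have hne : x - y ≠ 0 := sub_ne_zero.2 hxy
  have hgeom := (Commute.all x y).geom_sum₂_mul (k + 1)
  rw [add_tsub_cancel_right, ← Finset.Nat.sum_antidiagonal_eq_sum_range_succ_mk
    fun p : ℕ × ℕ => x ^ p.1 * y ^ p.2] at hgeom
  have hinner : ∑ p : Finset.HasAntidiagonal.antidiagonal k,
      x ^ (p : ℕ × ℕ).1 * y ^ (p : ℕ × ℕ).2 *
      g ((p : ℕ × ℕ).1 + (p : ℕ × ℕ).2) =
      (∑ p ∈ Finset.HasAntidiagonal.antidiagonal k, x ^ p.1 * y ^ p.2) * g k := by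
    rw [Finset.sum_coe_sort (Finset.HasAntidiagonal.antidiagonal k) fun p : ℕ × ℕ =>
      x ^ p.1 * y ^ p.2 * g (p.1 + p.2), Finset.sum_mul]
    exact Finset.sum_congr rfl fun p hp => by rw [Finset.HasAntidiagonal.mem_antidiagonal.1 hp]
  refine Eq.trans ?_ hinner.symm
  rw [eq_div_of_mul_eq hne hgeom]
  field_simp
  ring

theorem integral_Pfun_mul_Pfun {α w₁ w₂ : ℝ} (hα : 0 < α) (hw₁ : -1 < w₁) (hw₂ : -1 < w₂)
    {lam sig : ℂ} (hls : lam ≠ sig) {t : ℝ} (ht : 0 < t) :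
    ∫ τ in (0 : ℝ)..t, Pfun α w₁ lam (t - τ) * Pfun α w₂ sig τ =
      (1 / (lam - sig)) *
        (lam * Pfun α ((w₁ + w₂) + 1) lam t - sig * Pfun α ((w₁ + w₂) + 1) sig t) := by
  have hw : -1 < w₁ + w₂ + 1 := by linarith
  have hn₁ := neg_one_lt_mul_natCast_add hα hw₁
  have hn₂ := neg_one_lt_mul_natCast_add hα hw₂
  set g : ℕ → ℝ := fun k => powGamma (α * k + (w₁ + w₂ + 1)) t with hg
  set K : ℕ × ℕ → ℝ → ℝ := fun p τ =>
    powGamma (α * p.1 + w₁) (t - τ) * powGamma (α * p.2 + w₂) τ with hK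
  set F : ℕ × ℕ → ℝ → ℂ := fun p τ => lam ^ p.1 * sig ^ p.2 * (K p τ : ℂ) with hF
  have hKint : ∀ p, ∫ τ in Set.Ioo 0 t, K p τ = g (p.1 + p.2) := fun p => by
    rw [hK, integral_powGamma_mul (hn₁ _) (hn₂ _) ht, hg]
    simp only
    congr 1
    push_cast
    ring
  have hKnn : ∀ p, ∀ τ ∈ Set.Ioo 0 t, 0 ≤ K p τ := fun p τ hτ =>
    mul_nonneg (powGamma_nonneg (hn₁ _) (by linarith [hτ.2])) (powGamma_nonneg (hn₂ _) hτ.1.le)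
  have hFint : ∀ p, ∫ τ in Set.Ioo 0 t, F p τ =
      lam ^ p.1 * sig ^ p.2 * (g (p.1 + p.2) : ℂ) := fun p => by
    rw [hF, integral_const_mul, integral_complex_ofReal, hKint]
  have hFnorm : ∀ p, ∫ τ in Set.Ioo 0 t, ‖F p τ‖ =
      ‖lam‖ ^ p.1 * ‖sig‖ ^ p.2 * g (p.1 + p.2) := fun p => by
    rw [← hKint p, ← integral_const_mul]
    refine setIntegral_congr_fun measurableSet_Ioo fun τ hτ => ?_
    simp only [hF]
    rw [norm_mul, norm_mul, norm_pow, norm_pow, Complex.norm_real,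
      Real.norm_of_nonneg (hKnn p τ hτ)]
  have hsum := hasSum_integral_of_summable_integral_norm (μ := volume.restrict (Set.Ioo 0 t))
    (F := F) (fun p => (integrableOn_powGamma_mul (hn₁ _) (hn₂ _) ht).ofReal.const_mul _) (by
      simp_rw [hFnorm]
      exact summable_pow_mul_pow_mul (norm_nonneg _) (norm_nonneg _)
        (fun k => powGamma_nonneg (neg_one_lt_mul_natCast_add hα hw k) ht.le)
        fun z hz => summable_pow_mul_powGamma hα _ ht hz)
  have htsum : ∫ τ in Set.Ioo 0 t, ∑' p, F p τ =
      ∫ τ in (0 : ℝ)..t, Pfun α w₁ lam (t - τ) * Pfun α w₂ sig τ := by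
    rw [intervalIntegral.integral_of_le ht.le, integral_Ioc_eq_integral_Ioo]
    refine setIntegral_congr_fun measurableSet_Ioo fun τ hτ => ?_
    have hτ' : 0 < t - τ := by linarith [hτ.2]
    rw [Pfun_eq_tsum α w₁ lam hτ', Pfun_eq_tsum α w₂ sig hτ.1,
      tsum_mul_tsum_of_summable_norm (summable_norm_pow_mul_powGamma hα hw₁ lam hτ')
        (summable_norm_pow_mul_powGamma hα hw₂ sig hτ.1)]
    refine tsum_congr fun p => ?_
    simp only [hF, hK]
    push_cast
    ring
  simp_rw [hFint, htsum] at hsum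
  refine (HasSum.pow_mul_pow_antidiagonal hls (g := fun k => (g k : ℂ)) hsum).unique ?_
  exact (((hasSum_Pfun hα hw lam ht).mul_left lam).sub
    ((hasSum_Pfun hα hw sig ht).mul_left sig)).mul_left _

/-- Same-order convolution identity for `P` functions with distinct
eigenvalues, together with its equivalent Mittag-Leffler form. -/
theorem conv_Pfun_same_order (α w₁ w₂ : ℝ) (hα : 0 < α) (hw₁ : -1 < w₁) (hw₂ : -1 < w₂)
    (lam sig : ℂ) (hls : lam ≠ sig) (t : ℝ) (ht : 0 < t) :
    ((∫ τ in (0 : ℝ)..t, Pfun α w₁ lam (t - τ) * Pfun α w₂ sig τ) =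
      (1 / (lam - sig)) *
        (lam * Pfun α ((w₁ + w₂) + 1) lam t - sig * Pfun α ((w₁ + w₂) + 1) sig t)) ∧
    ((∫ τ in (0 : ℝ)..t,
        (((t - τ) ^ w₁ : ℝ) : ℂ) * mlE α (w₁ + 1) (lam * (((t - τ) ^ α : ℝ) : ℂ)) *
          ((((τ : ℝ) ^ w₂ : ℝ) : ℂ) * mlE α (w₂ + 1) (sig * (((τ : ℝ) ^ α : ℝ) : ℂ)))) =
      ((t ^ ((w₁ + w₂) + 1) : ℝ) : ℂ) / (lam - sig) *
        (lam * mlE α ((w₁ + w₂) + 2) (lam * ((t ^ α : ℝ) : ℂ)) -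
          sig * mlE α ((w₁ + w₂) + 2) (sig * ((t ^ α : ℝ) : ℂ)))) := by
  refine ⟨integral_Pfun_mul_Pfun hα hw₁ hw₂ hls ht,
    (integral_Pfun_mul_Pfun hα hw₁ hw₂ hls ht).trans ?_⟩
  rw [Pfun, Pfun, show w₁ + w₂ + 1 + 1 = w₁ + w₂ + 2 by ring]
  ring
end

section
/- Generalized Euler identity for P functions: for every positive integer N, every real α > 0, every w > −1, every λ ∈ ℂ, and every t > 0, P_{α,w}(λ,t) = ∑_{ℓ=0}^{N−1} λ^ℓ P_{Nα, w+ℓα}(λ^N, t). -/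
open MeasureTheory

/-- The Gamma function dominates every exponential. -/
theorem rpow_le_const_mul_Gamma {M x : ℝ} (hM : 1 ≤ M) (hx : 2 ≤ x) :
    M ^ x ≤ M ^ 2 * Real.exp M * Real.Gamma x := by
  have hM0 : 0 < M := by linarith
  obtain ⟨k, hk⟩ : ∃ k : ℕ, ⌊x⌋₊ = k + 1 + 1 :=
    ⟨⌊x⌋₊ - 2, by have := Nat.le_floor (n := 2) (by exact_mod_cast hx : ((2 : ℕ) : ℝ) ≤ x); omega⟩
  have h1 : ((k + 1 : ℕ) : ℝ) + 1 ≤ x := by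
    have := Nat.floor_le (by linarith : 0 ≤ x)
    rw [hk] at this
    exact_mod_cast this
  have h2 : x ≤ ((k + 1 + 2 : ℕ) : ℝ) := by
    have := Nat.lt_floor_add_one x
    rw [hk] at this
    push_cast at this ⊢
    linarith
  have hΓ : ((k + 1).factorial : ℝ) ≤ Real.Gamma x := by
    rw [← Real.Gamma_nat_eq_factorial]
    refine Real.Gamma_strictMonoOn_Ici.monotoneOn ?_ ?_ h1
    · simp only [Set.mem_Ici]
      push_cast
      linarith [(Nat.cast_nonneg k : (0 : ℝ) ≤ k)]
    · exact hx
  have hexp := Real.pow_div_factorial_le_exp M hM0.le (k + 1)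
  rw [div_le_iff₀ (by positivity)] at hexp
  calc M ^ x ≤ M ^ ((k + 1 + 2 : ℕ) : ℝ) := Real.rpow_le_rpow_of_exponent_le hM h2
    _ = M ^ 2 * M ^ (k + 1) := by rw [Real.rpow_natCast]; ring
    _ ≤ M ^ 2 * (Real.exp M * Real.Gamma x) := by
      gcongr
      exact hexp.trans (by gcongr)
    _ = M ^ 2 * Real.exp M * Real.Gamma x := by ring

/-- The Mittag-Leffler series converges everywhere. -/
theorem summable_mlE {α : ℝ} (hα : 0 < α) (β : ℝ) (z : ℂ) :
    Summable fun n : ℕ => z ^ n * (Complex.Gamma ((α * n + β : ℝ) : ℂ))⁻¹ := by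
  set r : ℝ := ‖z‖ + 1 with hr
  have hr1 : 1 ≤ r := by linarith [norm_nonneg z]
  have hr0 : 0 < r := by linarith
  set M : ℝ := r ^ α⁻¹ with hM
  have hM1 : 1 ≤ M := Real.one_le_rpow hr1 (by positivity)
  have hM0 : 0 < M := by linarith
  have hgeom : Summable fun n : ℕ => M ^ 2 * Real.exp M * M ^ (-β) * (‖z‖ / r) ^ n :=
    (summable_geometric_of_lt_one (by positivity)
      ((div_lt_one hr0).2 (by linarith))).mul_left _
  refine hgeom.of_norm_bounded_eventually_nat ?_
  have hlim : Filter.Tendsto (fun n : ℕ => α * (n : ℝ) + β) Filter.atTop Filter.atTop :=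
    Filter.tendsto_atTop_add_const_right _ _
      (tendsto_natCast_atTop_atTop.const_mul_atTop hα)
  filter_upwards [hlim.eventually_ge_atTop 2] with n hn
  have hΓ : 0 < Real.Gamma (α * n + β) := Real.Gamma_pos_of_pos (by linarith)
  have hpow : M ^ (α * n + β) = r ^ n * M ^ β := by
    rw [Real.rpow_add hM0, hM, ← Real.rpow_mul hr0.le, inv_mul_cancel_left₀ hα.ne',
      Real.rpow_natCast]
  have hbound := rpow_le_const_mul_Gamma hM1 hn
  rw [hpow] at hbound
  rw [Complex.Gamma_ofReal, norm_mul, norm_pow, norm_inv, Complex.norm_real, Real.norm_eq_abs,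
    abs_of_pos hΓ, Real.rpow_neg hM0.le, div_pow]
  have hβ : 0 < M ^ β := Real.rpow_pos_of_pos hM0 β
  rw [← div_eq_mul_inv, div_le_iff₀ hΓ]
  calc ‖z‖ ^ n = ‖z‖ ^ n * (r ^ n * M ^ β) / (r ^ n * M ^ β) := by field_simp
    _ ≤ ‖z‖ ^ n * (M ^ 2 * Real.exp M * Real.Gamma (α * n + β)) / (r ^ n * M ^ β) := by gcongr
    _ = _ := by field_simp

/-- The general term of the series defining `Pfun`. -/
noncomputable def PfunTerm (α w : ℝ) (lam : ℂ) (t : ℝ) (n : ℕ) : ℂ :=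
  lam ^ n * ((t ^ (α * n + w) : ℝ) : ℂ) * (Complex.Gamma ((α * n + w + 1 : ℝ) : ℂ))⁻¹

theorem PfunTerm_eq (α w : ℝ) (lam : ℂ) {t : ℝ} (ht : 0 < t) (n : ℕ) :
    PfunTerm α w lam t n = ((t ^ w : ℝ) : ℂ) *
      ((lam * ((t ^ α : ℝ) : ℂ)) ^ n * (Complex.Gamma ((α * n + (w + 1) : ℝ) : ℂ))⁻¹) := by
  rw [PfunTerm, Real.rpow_add ht, Real.rpow_mul ht.le, Real.rpow_natCast, ← add_assoc]
  push_cast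
  ring

theorem hasSum_PfunTerm {α : ℝ} (hα : 0 < α) (w : ℝ) (lam : ℂ) {t : ℝ} (ht : 0 < t) :
    HasSum (PfunTerm α w lam t) (Pfun α w lam t) := by
  rw [funext (PfunTerm_eq α w lam ht)]
  exact (summable_mlE hα (w + 1) _).hasSum.mul_left _

theorem PfunTerm_add_mul (N : ℕ) (α w : ℝ) (lam : ℂ) (t : ℝ) (ℓ m : ℕ) :
    PfunTerm α w lam t (ℓ + N * m) =
      lam ^ ℓ * PfunTerm (N * α) (w + ℓ * α) (lam ^ N) t m := by
  have h : α * ((ℓ + N * m : ℕ) : ℝ) + w = N * α * m + (w + ℓ * α) := by push_cast; ring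
  rw [PfunTerm, PfunTerm, h, pow_add, pow_mul]
  ring

/-- Generalized Euler identity for `P` functions:
`P_{α,w}(λ,t) = ∑_{ℓ=0}^{N-1} λ^ℓ P_{Nα, w+ℓα}(λ^N, t)`. -/
theorem Pfun_euler_expansion (N : ℕ) (hN : 0 < N) (α w : ℝ) (hα : 0 < α) (hw : -1 < w)
    (lam : ℂ) (t : ℝ) (ht : 0 < t) :
    Pfun α w lam t =
      ∑ ℓ ∈ Finset.range N, lam ^ ℓ * Pfun ((N : ℝ) * α) (w + (ℓ : ℝ) * α) (lam ^ N) t := by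
  have : NeZero N := ⟨hN.ne'⟩
  have hNα : 0 < (N : ℝ) * α := by positivity
  have hP := hasSum_PfunTerm hα w lam ht
  rw [← hP.tsum_eq, Nat.sumByResidueClasses hP.summable N]
  simp_rw [PfunTerm_add_mul]
  rw [← Fin.sum_univ_eq_sum_range
    (fun ℓ => lam ^ ℓ * Pfun ((N : ℝ) * α) (w + (ℓ : ℝ) * α) (lam ^ N) t)]
  refine Fintype.sum_equiv (ZMod.finEquiv N).symm.toEquiv _ _ fun j => ?_
  rw [((hasSum_PfunTerm hNα _ _ ht).mul_left _).tsum_eq]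
  obtain ⟨k, rfl⟩ := Nat.exists_eq_succ_of_ne_zero hN.ne'
  rfl
end
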